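/- For any three interval numbers γ₁ = (a, b), γ₂ = (c, d), γ₃ = (e, f) with components in [0, 1] and lower endpoint at most upper endpoint, the operator O₄ distributes over the componentwise intersection: (γ₁ ⊓ γ₂) O₄ γ₃ = (γ₁ O₄ γ₃) ⊓ (γ₂ O₄ γ₃), where ⊓ denotes componentwise minimum. Equivalently, for all x, y, z ∈ [0, 1], (min(x, y) ∗ z)/2 = min((x ∗ z)/2, (y ∗ z)/2). -/

import Mathlib

/-- Ring sum of interval numbers: `(a, b) ⊕ (c, d) = (a + c - a*c, b + d - b*d)`. -/
def ringSum (g1 g2 : ℝ × ℝ) : ℝ × ℝ := (g1.1 + g2.1 - g1.1 * g2.1, g1.2 + g2.2 - g1.2 * g2.2)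

/-- Componentwise intersection (minimum) of interval numbers. -/
def intvInter (g1 g2 : ℝ × ℝ) : ℝ × ℝ := (min g1.1 g2.1, min g1.2 g2.2)

/-- Componentwise union (maximum) of interval numbers. -/
def intvUnion (g1 g2 : ℝ × ℝ) : ℝ × ℝ := (max g1.1 g2.1, max g1.2 g2.2)

/-- The star operation on reals: `x ∗ y = (x + y) / (2 * (x * y + 1))`. -/
noncomputable def star (x y : ℝ) : ℝ := (x + y) / (2 * (x * y + 1))

/-- The operator `O₄`: `(a,b) O₄ (c,d) = ((a ∗ c)/2, (b ∗ d)/2)`. -/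
noncomputable def opO4 (g1 g2 : ℝ × ℝ) : ℝ × ℝ := (star g1.1 g2.1 / 2, star g1.2 g2.2 / 2)

/-- For `z ∈ [0, 1]`, the map `x ↦ x ∗ z` is monotone on the nonnegative reals. -/
theorem star_mono_left {x y z : ℝ} (hx : 0 ≤ x) (hxy : x ≤ y) (hz : 0 ≤ z) (hz1 : z ≤ 1) :
    _root_.star x z ≤ _root_.star y z := by
  have hxz : 0 ≤ x * z := mul_nonneg hx hz
  have hyz : 0 ≤ y * z := mul_nonneg (hx.trans hxy) hz
  have hzz : z * z ≤ 1 := mul_le_one₀ hz1 hz hz1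
  unfold _root_.star
  rw [div_le_div_iff₀ (by positivity) (by positivity)]
  nlinarith [mul_nonneg (sub_nonneg.2 hxy) (sub_nonneg.2 hzz)]

/-- For `z ∈ [0, 1]`, halved `∗` distributes over minima of nonnegative reals. -/
theorem star_min_div_two {x y z : ℝ} (hx : 0 ≤ x) (hy : 0 ≤ y) (hz : 0 ≤ z) (hz1 : z ≤ 1) :
    _root_.star (min x y) z / 2 = min (_root_.star x z / 2) (_root_.star y z / 2) := by
  rcases le_total x y with h | h
  · have := star_mono_left hx h hz hz1
    rw [min_eq_left h, min_eq_left (by linarith)]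
  · have := star_mono_left hy h hz hz1
    rw [min_eq_right h, min_eq_right (by linarith)]

theorem opO4_distrib_inter (a b c d e f : ℝ)
    (ha : 0 ≤ a) (hab : a ≤ b) (hb : b ≤ 1)
    (hc : 0 ≤ c) (hcd : c ≤ d) (hd : d ≤ 1)
    (he : 0 ≤ e) (hef : e ≤ f) (hf : f ≤ 1) :
    opO4 (intvInter (a, b) (c, d)) (e, f) =
      intvInter (opO4 (a, b) (e, f)) (opO4 (c, d) (e, f)) := by
  exact Prod.ext (star_min_div_two ha hc he (hef.trans hf))
    (star_min_div_two (ha.trans hab) (hc.trans hcd) (he.trans hef) hf)
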